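/- arXiv:2506.00196 — 14 statements merged into one kernel-verified Lean document; each statement's English description precedes it below -/
import Mathlib

section
/- Fix τ > 0, λ > 0, and s ∈ ℝⁿ. Suppose y ∈ ℝⁿ satisfies, for every index i: y_i = (Π_Ω(s))_i whenever s_i² − ((Π_Ω(s))_i − s_i)² > 2λτ; y_i = 0 whenever s_i² − ((Π_Ω(s))_i − s_i)² < 2λτ; and y_i ∈ {(Π_Ω(s))_i, 0} whenever s_i² − ((Π_Ω(s))_i − s_i)² = 2λτ. Then y ∈ Ω and y is a minimizer over Ω of the function v ↦ ½‖v − s‖² + τλ‖v‖₀, i.e. y ∈ Prox_{τλ‖·‖₀}(s). -/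
open scoped RealInnerProductSpace Classical BigOperators

noncomputable section

/-- The box constraint set `Ω = {x | -l i ≤ x i ≤ u i for all i}`. -/
def box {n : ℕ} (l u : Fin n → ℝ) : Set (EuclideanSpace ℝ (Fin n)) :=
  {x | ∀ i, -l i ≤ x i ∧ x i ≤ u i}

/-- `‖x‖₀`: the number of nonzero components of `x` (as a real number). -/
def norm0 {n : ℕ} (x : EuclideanSpace ℝ (Fin n)) : ℝ :=
  ((Finset.univ.filter (fun i => x i ≠ 0)).card : ℝ)

/-- The support of `x`. -/
def supp {n : ℕ} (x : EuclideanSpace ℝ (Fin n)) : Set (Fin n) := {i | x i ≠ 0}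

/-- `‖x‖_{2,0}`: the number of groups on which `x` is nonzero (as a real number). -/
def norm20 {n q : ℕ} (G : Fin q → Finset (Fin n)) (x : EuclideanSpace ℝ (Fin n)) : ℝ :=
  ((Finset.univ.filter (fun i : Fin q => ∃ j ∈ G i, x j ≠ 0)).card : ℝ)

/-- `G` is a partition of `{1,…,n}` into nonempty pairwise disjoint groups. -/
def GroupPartition {n q : ℕ} (G : Fin q → Finset (Fin n)) : Prop :=
  (∀ i, (G i).Nonempty) ∧ (∀ i j, i ≠ j → Disjoint (G i) (G j)) ∧
    Finset.univ.biUnion G = Finset.univ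

/-- The Euclidean norm of the subvector `x_{G i}`. -/
def groupNorm {n q : ℕ} (G : Fin q → Finset (Fin n)) (x : EuclideanSpace ℝ (Fin n))
    (i : Fin q) : ℝ :=
  Real.sqrt (∑ j ∈ G i, (x j) ^ 2)

/-- `‖x_{G i}‖₀`: the number of nonzero components of the subvector `x_{G i}`. -/
def groupNorm0 {n q : ℕ} (G : Fin q → Finset (Fin n)) (x : EuclideanSpace ℝ (Fin n))
    (i : Fin q) : ℝ :=
  (((G i).filter (fun j => x j ≠ 0)).card : ℝ)

/-- `Prox_{τλ‖·‖₀}(s)`: the set of minimizers over the box of `½‖y-s‖² + τλ‖y‖₀`. -/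
def proxL0 {n : ℕ} (l u : Fin n → ℝ) (τ lam : ℝ) (s : EuclideanSpace ℝ (Fin n)) :
    Set (EuclideanSpace ℝ (Fin n)) :=
  {y | y ∈ box l u ∧ ∀ v ∈ box l u,
    (1 / 2) * ‖y - s‖ ^ 2 + τ * lam * norm0 y ≤ (1 / 2) * ‖v - s‖ ^ 2 + τ * lam * norm0 v}

/-- `Prox_{τp}(s)`: the set of minimizers over the box of
`½‖y-s‖² + τλ‖y‖₀ + τμ‖y‖_{2,0}`. -/
def proxP {n q : ℕ} (l u : Fin n → ℝ) (G : Fin q → Finset (Fin n)) (τ lam μ : ℝ)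
    (s : EuclideanSpace ℝ (Fin n)) : Set (EuclideanSpace ℝ (Fin n)) :=
  {y | y ∈ box l u ∧ ∀ v ∈ box l u,
    (1 / 2) * ‖y - s‖ ^ 2 + τ * lam * norm0 y + τ * μ * norm20 G y ≤
      (1 / 2) * ‖v - s‖ ^ 2 + τ * lam * norm0 v + τ * μ * norm20 G v}

/-- `φ(x) = f(x) + λ‖x‖₀ + μ‖x‖_{2,0}`. -/
def phi {n q : ℕ} (G : Fin q → Finset (Fin n)) (f : EuclideanSpace ℝ (Fin n) → ℝ)
    (lam μ : ℝ) (x : EuclideanSpace ℝ (Fin n)) : ℝ :=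
  f x + lam * norm0 x + μ * norm20 G x

/-- `f` is strongly smooth with constant `L`, with gradient map `g`. -/
def StronglySmooth {n : ℕ} (f : EuclideanSpace ℝ (Fin n) → ℝ)
    (g : EuclideanSpace ℝ (Fin n) → EuclideanSpace ℝ (Fin n)) (L : ℝ) : Prop :=
  (∀ x, HasGradientAt f (g x) x) ∧
    ∀ x z, f z ≤ f x + ⟪g x, z - x⟫ + (L / 2) * ‖z - x‖ ^ 2

/-- `P` is the Euclidean projection of `s` onto the box. -/
def IsProj {n : ℕ} (l u : Fin n → ℝ) (s P : EuclideanSpace ℝ (Fin n)) : Prop :=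
  P ∈ box l u ∧ ∀ v ∈ box l u, ‖P - s‖ ≤ ‖v - s‖

/-- the componentwise hard-thresholding formula gives a point of
`Prox_{τλ‖·‖₀}(s)`. -/
theorem stmt_0 {n : ℕ} (l u : Fin n → ℝ) (hl : ∀ i, 0 ≤ l i) (hu : ∀ i, 0 ≤ u i)
    (τ lam : ℝ) (hτ : 0 < τ) (hlam : 0 < lam)
    (s P y : EuclideanSpace ℝ (Fin n)) (hP : IsProj l u s P)
    (h1 : ∀ i, 2 * lam * τ < (s i) ^ 2 - (P i - s i) ^ 2 → y i = P i)
    (h2 : ∀ i, (s i) ^ 2 - (P i - s i) ^ 2 < 2 * lam * τ → y i = 0)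
    (h3 : ∀ i, (s i) ^ 2 - (P i - s i) ^ 2 = 2 * lam * τ → y i = P i ∨ y i = 0) :
    y ∈ proxL0 l u τ lam s := by
  have hbox := hP.1
  have key : ∀ i, ∀ w : ℝ, -l i ≤ w → w ≤ u i → (P i - s i) ^ 2 ≤ (w - s i) ^ 2 := by
    intro i w hw1 hw2
    have hv : (WithLp.toLp 2 (Function.update (fun j => P j) i w) :
        EuclideanSpace ℝ (Fin n)) ∈ box l u := by
      intro j
      by_cases hj : j = i
      · subst hj
        simp [hw1, hw2]
      · simpa [hj] using hbox j
    have h := hP.2 _ hv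
    have h' := pow_le_pow_left₀ (norm_nonneg _) h 2
    rw [EuclideanSpace.real_norm_sq_eq, EuclideanSpace.real_norm_sq_eq] at h'
    rw [← Finset.add_sum_erase _ _ (Finset.mem_univ i),
      ← Finset.add_sum_erase _ _ (Finset.mem_univ i)] at h'
    have e : ∑ x ∈ Finset.univ.erase i, ((P - s) x) ^ 2 =
        ∑ x ∈ Finset.univ.erase i,
          (((WithLp.toLp 2 (Function.update (fun j => P j) i w) :
            EuclideanSpace ℝ (Fin n)) - s) x) ^ 2 := by
      apply Finset.sum_congr rfl
      intro j hj
      simp [Finset.ne_of_mem_erase hj]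
    rw [e] at h'
    have h'' := le_of_add_le_add_right h'
    simpa using h''
  have cases : ∀ i, (y i = P i ∧ 2 * lam * τ ≤ (s i) ^ 2 - (P i - s i) ^ 2) ∨
      (y i = 0 ∧ (s i) ^ 2 - (P i - s i) ^ 2 ≤ 2 * lam * τ) := by
    intro i
    rcases lt_trichotomy ((s i) ^ 2 - (P i - s i) ^ 2) (2 * lam * τ) with h | h | h
    · exact Or.inr ⟨h2 i h, h.le⟩
    · rcases h3 i h with h' | h'
      · exact Or.inl ⟨h', h.ge⟩
      · exact Or.inr ⟨h', h.le⟩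
    · exact Or.inl ⟨h1 i h, h.le⟩
  refine ⟨?_, ?_⟩
  · intro i
    rcases cases i with ⟨h, _⟩ | ⟨h, _⟩
    · rw [h]; exact hbox i
    · rw [h]; exact ⟨by linarith [hl i], hu i⟩
  · intro v hv
    have expand : ∀ x : EuclideanSpace ℝ (Fin n),
        (1 / 2) * ‖x - s‖ ^ 2 + τ * lam * norm0 x =
        ∑ i, ((1 / 2) * (x i - s i) ^ 2 + τ * lam * (if x i ≠ 0 then 1 else 0)) := by
      intro x
      rw [EuclideanSpace.real_norm_sq_eq, Finset.sum_add_distrib, ← Finset.mul_sum,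
        ← Finset.mul_sum, norm0, Finset.sum_boole]
      rfl
    rw [expand, expand]
    apply Finset.sum_le_sum
    intro i _
    have hpos : 0 < τ * lam := mul_pos hτ hlam
    have k := key i (v i) (hv i).1 (hv i).2
    by_cases hv0 : v i = 0
    · rcases cases i with ⟨h, hh⟩ | ⟨h, hh⟩
      · rw [h, hv0]
        by_cases hp : P i = 0
        · simp [hp]
        · simp only [ne_eq, hp, not_false_eq_true, if_true, not_true_eq_false, if_false]
          nlinarith
      · rw [h, hv0]
    · rcases cases i with ⟨h, hh⟩ | ⟨h, hh⟩
      · rw [h]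
        by_cases hp : P i = 0
        · simp only [ne_eq, hp, hv0, not_false_eq_true, if_true, not_true_eq_false, if_false]
          rw [hp] at k
          nlinarith
        · simp only [ne_eq, hp, hv0, not_false_eq_true, if_true]
          nlinarith
      · rw [h]
        simp only [ne_eq, hv0, not_false_eq_true, if_true, not_true_eq_false, if_false]
        nlinarith
end
end

section
/- Let f : ℝⁿ → ℝ and λ, μ ≥ 0. If x* ∈ Ω is a global minimizer of φ over Ω (i.e. φ(x*) ≤ φ(x) for all x ∈ Ω), then x* is a support optimal (SO) point, i.e. x* minimizes f over {x ∈ Ω : supp(x) ⊆ supp(x*)}. -/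
open scoped RealInnerProductSpace Classical BigOperators

noncomputable section

/-- a global minimizer of `φ` over `Ω` is a support optimal (SO) point. -/
theorem stmt_4 {n q : ℕ} (l u : Fin n → ℝ) (hl : ∀ i, 0 ≤ l i) (hu : ∀ i, 0 ≤ u i)
    (G : Fin q → Finset (Fin n)) (hG : GroupPartition G)
    (lam μ : ℝ) (hlam : 0 ≤ lam) (hμ : 0 ≤ μ)
    (f : EuclideanSpace ℝ (Fin n) → ℝ) (xs : EuclideanSpace ℝ (Fin n))
    (hxs : xs ∈ box l u)
    (hmin : ∀ x ∈ box l u, phi G f lam μ xs ≤ phi G f lam μ x) :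
    ∀ x ∈ box l u, supp x ⊆ supp xs → f xs ≤ f x := by
  intro x hx hs
  have h := hmin x hx
  have h0 : norm0 x ≤ norm0 xs := by
    unfold norm0
    refine Nat.cast_le.mpr (Finset.card_le_card ?_)
    intro i hi
    rw [Finset.mem_filter] at hi ⊢
    exact ⟨hi.1, hs hi.2⟩
  have h2 : norm20 G x ≤ norm20 G xs := by
    unfold norm20
    refine Nat.cast_le.mpr (Finset.card_le_card ?_)
    intro i hi
    rw [Finset.mem_filter] at hi ⊢
    obtain ⟨hi1, j, hj, hxj⟩ := hi
    exact ⟨hi1, j, hj, hs hxj⟩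
  unfold phi at h
  have a := mul_le_mul_of_nonneg_left h0 hlam
  have b := mul_le_mul_of_nonneg_left h2 hμ
  linarith
end
end

section
/- Let f : ℝⁿ → ℝ be convex and differentiable, λ > 0, μ ≥ 0. If x* ∈ Ω is a support optimal (SO) point, then x* is a local minimizer of φ over Ω: there exists ε > 0 such that φ(x*) ≤ φ(x) for all x ∈ Ω with ‖x − x*‖ < ε. -/
open scoped RealInnerProductSpace Classical BigOperators

noncomputable section

/-- for convex differentiable `f` and `λ > 0`, a support optimal point is a
local minimizer of `φ` over `Ω`. -/
theorem stmt_5 {n q : ℕ} (l u : Fin n → ℝ) (hl : ∀ i, 0 ≤ l i) (hu : ∀ i, 0 ≤ u i)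
    (G : Fin q → Finset (Fin n)) (hG : GroupPartition G)
    (lam μ : ℝ) (hlam : 0 < lam) (hμ : 0 ≤ μ)
    (f : EuclideanSpace ℝ (Fin n) → ℝ)
    (hconv : ConvexOn ℝ Set.univ f) (hdiff : Differentiable ℝ f)
    (xs : EuclideanSpace ℝ (Fin n)) (hxs : xs ∈ box l u)
    (hSO : ∀ x ∈ box l u, supp x ⊆ supp xs → f xs ≤ f x) :
    ∃ ε > 0, ∀ x ∈ box l u, ‖x - xs‖ < ε → phi G f lam μ xs ≤ phi G f lam μ x := by
  have hev : ∀ᶠ x in nhds xs, f xs - lam < f x ∧ ∀ i, xs i ≠ 0 → x i ≠ 0 := by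
    refine Filter.Eventually.and ?_ ?_
    · exact hdiff.continuous.continuousAt.eventually (lt_mem_nhds (by linarith))
    · rw [Filter.eventually_all]
      intro i
      by_cases h : xs i = 0
      · simp [h]
      · have hc : Continuous (fun x : EuclideanSpace ℝ (Fin n) => x i) := by fun_prop
        filter_upwards [hc.continuousAt.eventually_ne h] with x hx _ using hx
  obtain ⟨ε, hε, H⟩ := Metric.eventually_nhds_iff.1 hev
  refine ⟨ε, hε, fun x hx hd => ?_⟩
  obtain ⟨h1, h2⟩ := H (by rwa [dist_eq_norm])
  have h20 : norm20 G xs ≤ norm20 G x := by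
    unfold norm20
    refine Nat.cast_le.2 (Finset.card_le_card ?_)
    intro i hi
    simp only [Finset.mem_filter, Finset.mem_univ, true_and] at hi ⊢
    obtain ⟨j, hj, hj'⟩ := hi
    exact ⟨j, hj, h2 j hj'⟩
  have hm := mul_le_mul_of_nonneg_left h20 hμ
  have hsub : (Finset.univ.filter (fun i => xs i ≠ 0)) ⊆ Finset.univ.filter (fun i => x i ≠ 0) := by
    intro i hi
    simp only [Finset.mem_filter, Finset.mem_univ, true_and] at hi ⊢
    exact h2 i hi
  unfold phi
  by_cases hs : supp x ⊆ supp xs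
  · have hf := hSO x hx hs
    have h0 : norm0 xs ≤ norm0 x := Nat.cast_le.2 (Finset.card_le_card hsub)
    have := mul_le_mul_of_nonneg_left h0 hlam.le
    linarith
  · obtain ⟨i, hi, hi'⟩ := Set.not_subset.1 hs
    have hlt := Finset.card_lt_card (Finset.ssubset_iff_subset_ne.2 ⟨hsub, fun he => by
      have : i ∈ Finset.univ.filter (fun i => xs i ≠ 0) := by
        rw [he]
        simpa [supp] using hi
      exact hi' (by simpa [supp] using this)⟩)
    have h0 : norm0 xs + 1 ≤ norm0 x := by
      unfold norm0
      exact_mod_cast hlt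
    have := mul_le_mul_of_nonneg_left h0 hlam.le
    linarith
end
end

section
/- Let f : ℝⁿ → ℝ be convex and differentiable, λ > 0, μ ≥ 0, and let x, x* ∈ Ω. If supp(x*) is a proper subset of supp(x), then φ(x) − φ(x*) ≥ λ − ‖∇f(x*)‖ · ‖x − x*‖. -/
open scoped RealInnerProductSpace Classical BigOperators

noncomputable section

/-- if `supp(x*) ⊊ supp(x)` then `φ(x) - φ(x*) ≥ λ - ‖∇f(x*)‖·‖x - x*‖`. -/
theorem stmt_6 {n q : ℕ} (l u : Fin n → ℝ) (hl : ∀ i, 0 ≤ l i) (hu : ∀ i, 0 ≤ u i)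
    (G : Fin q → Finset (Fin n)) (hG : GroupPartition G)
    (lam μ : ℝ) (hlam : 0 < lam) (hμ : 0 ≤ μ)
    (f : EuclideanSpace ℝ (Fin n) → ℝ)
    (g : EuclideanSpace ℝ (Fin n) → EuclideanSpace ℝ (Fin n))
    (hconv : ConvexOn ℝ Set.univ f) (hf : ∀ y, HasGradientAt f (g y) y)
    (x xs : EuclideanSpace ℝ (Fin n)) (hx : x ∈ box l u) (hxs : xs ∈ box l u)
    (hss : supp xs ⊂ supp x) :
    lam - ‖g xs‖ * ‖x - xs‖ ≤ phi G f lam μ x - phi G f lam μ xs := by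
  have hgrad : ⟪g xs, x - xs⟫ ≤ f x - f xs := by
    have hline : ConvexOn ℝ Set.univ (fun t : ℝ => f (AffineMap.lineMap xs x t)) := by
      have := hconv.comp_affineMap (AffineMap.lineMap xs x : ℝ →ᵃ[ℝ] EuclideanSpace ℝ (Fin n))
      simpa [Function.comp_def] using this
    have hd : HasDerivAt (fun t : ℝ => f (AffineMap.lineMap xs x t)) ⟪g xs, x - xs⟫ 0 := by
      have h1 : HasDerivAt (fun t : ℝ => AffineMap.lineMap xs x t) (x - xs) (0 : ℝ) :=
        AffineMap.hasDerivAt_lineMap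
      have h2 := (hf (AffineMap.lineMap xs x (0 : ℝ))).hasFDerivAt.comp_hasDerivAt (0 : ℝ) h1
      simpa [Function.comp_def] using h2
    have h := hline.le_slope_of_hasDerivAt (Set.mem_univ 0) (Set.mem_univ 1) one_pos hd
    simpa [slope_def_field] using h
  have hcs : -(‖g xs‖ * ‖x - xs‖) ≤ ⟪g xs, x - xs⟫ :=
    (abs_le.mp (abs_real_inner_le_norm (g xs) (x - xs))).1
  have hsub : ∀ i, xs i ≠ 0 → x i ≠ 0 := fun i hi => hss.1 hi
  have h0 : norm0 xs + 1 ≤ norm0 x := by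
    obtain ⟨i, hi, hi'⟩ := Set.exists_of_ssubset hss
    have hlt : (Finset.univ.filter (fun i => xs i ≠ 0)).card
        < (Finset.univ.filter (fun i => x i ≠ 0)).card := by
      apply Finset.card_lt_card
      rw [Finset.ssubset_iff_of_subset]
      · exact ⟨i, Finset.mem_filter.mpr ⟨Finset.mem_univ _, hi⟩,
          fun h => hi' (Finset.mem_filter.mp h).2⟩
      · intro j hj
        exact Finset.mem_filter.mpr ⟨Finset.mem_univ _, hsub j (Finset.mem_filter.mp hj).2⟩
    unfold norm0
    exact_mod_cast hlt
  have h20 : norm20 G xs ≤ norm20 G x := by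
    unfold norm20
    have : (Finset.univ.filter (fun i : Fin q => ∃ j ∈ G i, xs j ≠ 0)).card
        ≤ (Finset.univ.filter (fun i : Fin q => ∃ j ∈ G i, x j ≠ 0)).card := by
      apply Finset.card_le_card
      intro k hk
      obtain ⟨j, hj, hj'⟩ := (Finset.mem_filter.mp hk).2
      exact Finset.mem_filter.mpr ⟨Finset.mem_univ _, j, hj, hsub j hj'⟩
    exact_mod_cast this
  have e1 := mul_le_mul_of_nonneg_left h0 hlam.le
  have e2 := mul_le_mul_of_nonneg_left h20 hμ
  unfold phi
  linarith
end
end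

section
/- Let f : ℝⁿ → ℝ be strongly smooth with constant L > 0, let λ, μ ≥ 0, and let 0 < τ < 1/L. For any x ∈ Ω and any y ∈ Prox_{τp}(x − τ∇f(x)), it holds that φ(x) − φ(y) ≥ ((1/τ − L)/2) · ‖y − x‖². -/
open scoped RealInnerProductSpace Classical BigOperators

noncomputable section

/-- sufficient decrease of `φ` for the proximal gradient mapping. -/
theorem stmt_7 {n q : ℕ} (l u : Fin n → ℝ) (hl : ∀ i, 0 ≤ l i) (hu : ∀ i, 0 ≤ u i)
    (G : Fin q → Finset (Fin n)) (hG : GroupPartition G)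
    (lam μ : ℝ) (hlam : 0 ≤ lam) (hμ : 0 ≤ μ)
    (f : EuclideanSpace ℝ (Fin n) → ℝ)
    (g : EuclideanSpace ℝ (Fin n) → EuclideanSpace ℝ (Fin n))
    (L : ℝ) (hL : 0 < L) (hsm : StronglySmooth f g L)
    (τ : ℝ) (hτ1 : 0 < τ) (hτ2 : τ < 1 / L)
    (x y : EuclideanSpace ℝ (Fin n)) (hx : x ∈ box l u)
    (hy : y ∈ proxP l u G τ lam μ (x - τ • g x)) :
    ((1 / τ - L) / 2) * ‖y - x‖ ^ 2 ≤ phi G f lam μ x - phi G f lam μ y := by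
  have h1 := hsm.2 x y
  have h2 := hy.2 x hx
  have e1 : y - (x - τ • g x) = (y - x) + τ • g x := by abel
  have e2 : x - (x - τ • g x) = τ • g x := by abel
  rw [e1, e2, norm_add_sq_real, inner_smul_right, real_inner_comm] at h2
  unfold phi
  have h3 : τ * (1 / τ) = 1 := by field_simp
  refine le_of_mul_le_mul_left ?_ hτ1
  have h4 := mul_le_mul_of_nonneg_left h1 hτ1.le
  have h5 : τ * ((1 / τ - L) / 2 * ‖y - x‖ ^ 2)
      = ‖y - x‖ ^ 2 / 2 - τ * (L / 2 * ‖y - x‖ ^ 2) := by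
    linear_combination (‖y - x‖ ^ 2 / 2) * h3
  rw [h5]
  linarith
end
end

section
/- Let f : ℝⁿ → ℝ be strongly smooth with constant L > 0 and let λ, μ ≥ 0. If x* ∈ Ω is a global minimizer of φ over Ω, then for every τ with 0 < τ < 1/L, x* is a τ-stationary point, i.e. x* ∈ Prox_{τp}(x* − τ∇f(x*)). -/
open scoped RealInnerProductSpace Classical BigOperators

noncomputable section

/-- a global minimizer of `φ` over `Ω` is a `τ`-stationary point for
every `0 < τ < 1/L`. -/
theorem stmt_8 {n q : ℕ} (l u : Fin n → ℝ) (hl : ∀ i, 0 ≤ l i) (hu : ∀ i, 0 ≤ u i)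
    (G : Fin q → Finset (Fin n)) (hG : GroupPartition G)
    (lam μ : ℝ) (hlam : 0 ≤ lam) (hμ : 0 ≤ μ)
    (f : EuclideanSpace ℝ (Fin n) → ℝ)
    (g : EuclideanSpace ℝ (Fin n) → EuclideanSpace ℝ (Fin n))
    (L : ℝ) (hL : 0 < L) (hsm : StronglySmooth f g L)
    (xs : EuclideanSpace ℝ (Fin n)) (hxs : xs ∈ box l u)
    (hmin : ∀ x ∈ box l u, phi G f lam μ xs ≤ phi G f lam μ x) :
    ∀ τ : ℝ, 0 < τ → τ < 1 / L → xs ∈ proxP l u G τ lam μ (xs - τ • g xs) := by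
  intro τ hτ hτL
  refine ⟨hxs, fun v hv => ?_⟩
  have h1 := hmin v hv
  have h2 := hsm.2 xs v
  unfold phi at h1
  have e1 : xs - (xs - τ • g xs) = τ • g xs := by abel
  have e2 : v - (xs - τ • g xs) = τ • g xs + (v - xs) := by abel
  rw [e1, e2, norm_add_sq_real, real_inner_smul_left]
  have hLτ : τ * L ≤ 1 := by
    rw [lt_div_iff₀ hL] at hτL
    exact hτL.le
  have h3 : τ * L * ‖v - xs‖ ^ 2 ≤ 1 * ‖v - xs‖ ^ 2 :=
    mul_le_mul_of_nonneg_right hLτ (sq_nonneg _)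
  have h4 : 0 ≤ τ * (⟪g xs, v - xs⟫ + (L / 2) * ‖v - xs‖ ^ 2 + lam * norm0 v
      + μ * norm20 G v - lam * norm0 xs - μ * norm20 G xs) :=
    mul_nonneg hτ.le (by linarith)
  linarith
end
end

section
/- Let f : ℝⁿ → ℝ be convex and differentiable, λ, μ ≥ 0, and τ > 0. If x* ∈ Ω is a τ-stationary point, then x* is a support optimal (SO) point, i.e. x* minimizes f over {x ∈ Ω : supp(x) ⊆ supp(x*)}. -/
open scoped RealInnerProductSpace Classical BigOperators

noncomputable section

/-- for convex differentiable `f`, a `τ`-stationary point is a support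
optimal (SO) point. -/
theorem stmt_9 {n q : ℕ} (l u : Fin n → ℝ) (hl : ∀ i, 0 ≤ l i) (hu : ∀ i, 0 ≤ u i)
    (G : Fin q → Finset (Fin n)) (hG : GroupPartition G)
    (lam μ : ℝ) (hlam : 0 ≤ lam) (hμ : 0 ≤ μ)
    (f : EuclideanSpace ℝ (Fin n) → ℝ)
    (g : EuclideanSpace ℝ (Fin n) → EuclideanSpace ℝ (Fin n))
    (hconv : ConvexOn ℝ Set.univ f) (hf : ∀ y, HasGradientAt f (g y) y)
    (τ : ℝ) (hτ : 0 < τ)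
    (xs : EuclideanSpace ℝ (Fin n)) (hxs : xs ∈ box l u)
    (hsta : xs ∈ proxP l u G τ lam μ (xs - τ • g xs)) :
    ∀ x ∈ box l u, supp x ⊆ supp xs → f xs ≤ f x := by
  intro x hx hsub
  have hin : 0 ≤ ⟪g xs, x - xs⟫ := by
    by_contra hneg
    push Not at hneg
    have key : ∀ t : ℝ, 0 < t → t ≤ 1 →
        0 ≤ t / 2 * ‖x - xs‖ ^ 2 + τ * ⟪g xs, x - xs⟫ := by
      intro t ht ht1
      have hvi : ∀ i, (xs + t • (x - xs)) i = xs i + t * (x i - xs i) := by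
        intro i; simp
      have hz : ∀ i, (xs + t • (x - xs)) i ≠ 0 → xs i ≠ 0 := by
        intro i hi h0
        have hx0 : x i = 0 := by
          by_contra h
          exact hsub (show i ∈ supp x from h) h0
        apply hi
        rw [hvi, h0, hx0]; ring
      have hv : xs + t • (x - xs) ∈ box l u := by
        intro i
        rw [hvi]
        obtain ⟨a1, a2⟩ := hxs i
        obtain ⟨b1, b2⟩ := hx i
        constructor <;> nlinarith
      have h := hsta.2 _ hv
      have h0 : norm0 (xs + t • (x - xs)) ≤ norm0 xs := by
        unfold norm0
        exact_mod_cast Finset.card_le_card (Finset.monotone_filter_right _ (fun i _ hi => hz i hi))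
      have h20 : norm20 G (xs + t • (x - xs)) ≤ norm20 G xs := by
        unfold norm20
        refine Nat.cast_le.mpr (Finset.card_le_card (Finset.monotone_filter_right _ ?_))
        rintro i _ ⟨j, hj, hi⟩
        exact ⟨j, hj, hz j hi⟩
      have e0 := mul_le_mul_of_nonneg_left h0 (mul_nonneg hτ.le hlam)
      have e20 := mul_le_mul_of_nonneg_left h20 (mul_nonneg hτ.le hμ)
      have r1 : xs - (xs - τ • g xs) = τ • g xs := by abel
      have r2 : xs + t • (x - xs) - (xs - τ • g xs) = τ • g xs + t • (x - xs) := by abel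
      rw [r1, r2, norm_add_sq_real, inner_smul_left, inner_smul_right, norm_smul t, mul_pow,
        Real.norm_eq_abs, sq_abs] at h
      simp only [conj_trivial] at h
      have h3 : 0 ≤ t * (t / 2 * ‖x - xs‖ ^ 2 + τ * ⟪g xs, x - xs⟫) := by nlinarith
      exact nonneg_of_mul_nonneg_right h3 ht
    set a := ⟪g xs, x - xs⟫
    set N := ‖x - xs‖ ^ 2 with hN
    have hN0 : 0 ≤ N := by positivity
    have hb : 0 < -(τ * a) := by nlinarith
    have hD : 0 < N + -(τ * a) := by linarith
    have := key (-(τ * a) / (N + -(τ * a))) (by positivity) (by rw [div_le_one hD]; linarith)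
    have h4 : -(τ * a) / (N + -(τ * a)) * N ≤ -(τ * a) := by
      rw [div_mul_eq_mul_div, div_le_iff₀ hD]; nlinarith
    linarith
  have hline : HasDerivAt (fun t : ℝ => f (AffineMap.lineMap xs x t)) ⟪g xs, x - xs⟫ 0 := by
    have h1 : HasDerivAt (fun t : ℝ => AffineMap.lineMap xs x t) (x - xs) (0 : ℝ) :=
      AffineMap.hasDerivAt_lineMap
    have h2 : HasFDerivAt f (InnerProductSpace.toDual ℝ _ (g xs))
        (AffineMap.lineMap xs x (0 : ℝ)) := by
      rw [AffineMap.lineMap_apply_zero]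
      exact (hf xs).hasFDerivAt
    have h3 := h2.comp_hasDerivAt (0 : ℝ) h1
    simpa [Function.comp_def] using h3
  have hc : ConvexOn ℝ Set.univ (fun t : ℝ => f (AffineMap.lineMap xs x t)) :=
    hconv.comp_affineMap (AffineMap.lineMap xs x)
  have := hc.le_slope_of_hasDerivAt (Set.mem_univ 0) (Set.mem_univ 1) one_pos hline
  simp [slope_def_field] at this
  linarith
end
end

section
/- Let f : ℝⁿ → ℝ be differentiable, λ, μ ≥ 0, and τ > 0. Suppose x* ∈ Ω is a τ-stationary point, and let 𝕏 = {y ∈ Ω : supp(y) ⊆ supp(x*)}. Then x* is the Euclidean projection of x* − τ∇f(x*) onto the closed convex set 𝕏, i.e. ‖x* − (x* − τ∇f(x*))‖ ≤ ‖y − (x* − τ∇f(x*))‖ for every y ∈ 𝕏. -/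
open scoped RealInnerProductSpace Classical BigOperators

noncomputable section

/-- a `τ`-stationary point `x*` is the Euclidean projection of
`x* - τ∇f(x*)` onto `𝕏 = {y ∈ Ω : supp(y) ⊆ supp(x*)}`. -/
theorem stmt_10 {n q : ℕ} (l u : Fin n → ℝ) (hl : ∀ i, 0 ≤ l i) (hu : ∀ i, 0 ≤ u i)
    (G : Fin q → Finset (Fin n)) (hG : GroupPartition G)
    (lam μ : ℝ) (hlam : 0 ≤ lam) (hμ : 0 ≤ μ)
    (f : EuclideanSpace ℝ (Fin n) → ℝ)
    (g : EuclideanSpace ℝ (Fin n) → EuclideanSpace ℝ (Fin n))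
    (hf : ∀ y, HasGradientAt f (g y) y)
    (τ : ℝ) (hτ : 0 < τ)
    (xs : EuclideanSpace ℝ (Fin n)) (hxs : xs ∈ box l u)
    (hsta : xs ∈ proxP l u G τ lam μ (xs - τ • g xs)) :
    ∀ y ∈ box l u, supp y ⊆ supp xs →
      ‖xs - (xs - τ • g xs)‖ ≤ ‖y - (xs - τ • g xs)‖ := by
  intro y hy hsupp
  have h := hsta.2 y hy
  have h0 : norm0 y ≤ norm0 xs := by
    unfold norm0
    refine Nat.cast_le.mpr (Finset.card_le_card ?_)
    intro i hi
    rw [Finset.mem_filter] at hi ⊢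
    exact ⟨hi.1, hsupp hi.2⟩
  have h2 : norm20 G y ≤ norm20 G xs := by
    unfold norm20
    refine Nat.cast_le.mpr (Finset.card_le_card ?_)
    intro i hi
    rw [Finset.mem_filter] at hi ⊢
    obtain ⟨hi1, j, hj, hjy⟩ := hi
    exact ⟨hi1, j, hj, hsupp hjy⟩
  have a := mul_le_mul_of_nonneg_left h0 (mul_nonneg hτ.le hlam)
  have b := mul_le_mul_of_nonneg_left h2 (mul_nonneg hτ.le hμ)
  refine (sq_le_sq₀ (norm_nonneg _) (norm_nonneg _)).mp ?_
  linarith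
end
end

section
/- Fix τ > 0, λ > 0, and s ∈ ℝⁿ. Define z ∈ ℝⁿ by z_i = (Π_Ω(s))_i if s_i² − ((Π_Ω(s))_i − s_i)² > 2λτ and z_i = 0 otherwise. Then δ > 0, and for every index j with z_j ≠ 0 it holds that |z_j| ≥ δ. -/
open scoped RealInnerProductSpace Classical BigOperators

noncomputable section

/-- The per-index lower bound `δ_i` from Lemma 3.3 of Lu. -/
def deltaI {n : ℕ} (l u : Fin n → ℝ) (τ lam : ℝ) (i : Fin n) : ℝ :=
  if l i = 0 then min (u i) (Real.sqrt (2 * lam * τ))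
  else if u i = 0 then min (l i) (Real.sqrt (2 * lam * τ))
  else min (l i) (min (u i) (Real.sqrt (2 * lam * τ)))

/-- nonzero components of the hard-thresholded vector `z` are bounded
below in magnitude by `δ = min_{i ∉ T} δ_i > 0`. -/
theorem stmt_11 {n : ℕ} (l u : Fin n → ℝ) (hl : ∀ i, 0 ≤ l i) (hu : ∀ i, 0 ≤ u i)
    (τ lam : ℝ) (hτ : 0 < τ) (hlam : 0 < lam)
    (hT : ∃ i, ¬(l i = 0 ∧ u i = 0))
    (δ : ℝ) (hδ : δ = sInf {d | ∃ i, ¬(l i = 0 ∧ u i = 0) ∧ d = deltaI l u τ lam i})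
    (s P z : EuclideanSpace ℝ (Fin n)) (hP : IsProj l u s P)
    (hz : ∀ i, z i = if 2 * lam * τ < (s i) ^ 2 - (P i - s i) ^ 2 then P i else 0) :
    0 < δ ∧ ∀ j, z j ≠ 0 → δ ≤ |z j| := by
  have hcoord : ∀ j w, -l j ≤ w → w ≤ u j → (P j - s j) ^ 2 ≤ (w - s j) ^ 2 := by
    intro j w h1 h2
    obtain ⟨hb, hm⟩ := hP
    let v : EuclideanSpace ℝ (Fin n) := WithLp.toLp 2 (Function.update (fun i => P i) j w)
    have hv : ∀ i, v i = Function.update (fun i => P i) j w i := fun i => rfl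
    have hvb : v ∈ box l u := by
      intro i
      rw [hv]
      by_cases hij : i = j
      · subst hij; simp [h1, h2]
      · simp only [Function.update_of_ne hij]; exact hb i
    have h := hm v hvb
    have h3 : ‖P - s‖ ^ 2 ≤ ‖v - s‖ ^ 2 := by gcongr
    rw [EuclideanSpace.real_norm_sq_eq, EuclideanSpace.real_norm_sq_eq,
      ← Finset.add_sum_erase _ _ (Finset.mem_univ j),
      ← Finset.add_sum_erase _ (fun i => ((v - s) i) ^ 2) (Finset.mem_univ j)] at h3
    have h4 : ∑ i ∈ Finset.univ.erase j, ((P - s) i) ^ 2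
        = ∑ i ∈ Finset.univ.erase j, ((v - s) i) ^ 2 := by
      apply Finset.sum_congr rfl
      intro i hi
      have hij : i ≠ j := Finset.ne_of_mem_erase hi
      simp only [PiLp.sub_apply, hv, Function.update_of_ne hij]
    rw [h4] at h3
    have h5 := le_of_add_le_add_right h3
    simpa only [PiLp.sub_apply, hv, Function.update_self] using h5
  have hpos : 0 < 2 * lam * τ := by positivity
  have hsq : 0 < Real.sqrt (2 * lam * τ) := Real.sqrt_pos.mpr hpos
  have hdpos : ∀ i, ¬(l i = 0 ∧ u i = 0) → 0 < deltaI l u τ lam i := by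
    intro i hi
    have h1 := hl i
    have h2 := hu i
    unfold deltaI
    split_ifs with a b
    · exact lt_min (lt_of_le_of_ne h2 (fun h => hi ⟨a, h.symm⟩)) hsq
    · exact lt_min (lt_of_le_of_ne h1 (Ne.symm a)) hsq
    · exact lt_min (lt_of_le_of_ne h1 (Ne.symm a)) (lt_min (lt_of_le_of_ne h2 (Ne.symm b)) hsq)
  have hfin : {d | ∃ i, ¬(l i = 0 ∧ u i = 0) ∧ d = deltaI l u τ lam i}.Finite := by
    apply (Set.finite_range (deltaI l u τ lam)).subset
    rintro d ⟨i, _, rfl⟩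
    exact ⟨i, rfl⟩
  refine ⟨?_, ?_⟩
  · obtain ⟨i, hi⟩ := hT
    have hne : {d | ∃ i, ¬(l i = 0 ∧ u i = 0) ∧ d = deltaI l u τ lam i}.Nonempty := ⟨_, i, hi, rfl⟩
    obtain ⟨k, hk, e⟩ := hne.csInf_mem hfin
    rw [hδ, e]
    exact hdpos k hk
  · intro j hj
    have hzj := hz j
    split_ifs at hzj with hc
    swap
    · exact absurd hzj hj
    rw [hzj] at hj ⊢
    obtain ⟨hb1, hb2⟩ := hP.1 j
    have hjT : ¬(l j = 0 ∧ u j = 0) := by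
      rintro ⟨a, b⟩
      apply hj
      linarith
    have hle : δ ≤ deltaI l u τ lam j := by
      rw [hδ]
      exact csInf_le hfin.bddBelow ⟨j, hjT, rfl⟩
    refine hle.trans ?_
    have hds : deltaI l u τ lam j ≤ Real.sqrt (2 * lam * τ) := by
      unfold deltaI
      split_ifs <;> simp
    have hdu : u j ≠ 0 → deltaI l u τ lam j ≤ u j := by
      intro h
      unfold deltaI
      rw [if_neg h]
      split_ifs <;> simp
    have hdl : l j ≠ 0 → deltaI l u τ lam j ≤ l j := by
      intro h
      unfold deltaI
      rw [if_neg h]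
      split_ifs <;> simp
    rcases lt_trichotomy (P j) (s j) with h | h | h
    · have hPu : P j = u j := by
        by_contra hne
        have hlt : P j < u j := lt_of_le_of_ne hb2 hne
        have := hcoord j (min (u j) (s j)) (le_min (by linarith) (by linarith)) (min_le_left _ _)
        have h1 : P j < min (u j) (s j) := lt_min hlt h
        have h2 : min (u j) (s j) ≤ s j := min_le_right _ _
        nlinarith
      rw [hPu] at hj ⊢
      exact (hdu hj).trans (le_abs_self _)
    · refine hds.trans (Real.sqrt_le_iff.mpr ⟨abs_nonneg _, ?_⟩)
      rw [sq_abs, h]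
      rw [h] at hc
      nlinarith
    · have hPl : P j = -l j := by
        by_contra hne
        have hlt : -l j < P j := lt_of_le_of_ne hb1 (Ne.symm hne)
        have := hcoord j (max (-l j) (s j)) (le_max_left _ _) (max_le (by linarith) (by linarith))
        have h1 : max (-l j) (s j) < P j := max_lt hlt h
        have h2 : s j ≤ max (-l j) (s j) := le_max_right _ _
        nlinarith
      rw [hPl] at hj ⊢
      rw [abs_neg]
      exact (hdl (fun h0 => hj (by simp [h0]))).trans (le_abs_self _)
end
end

section
/- Let f : ℝⁿ → ℝ be strongly smooth with constant L > 0 and bounded from below on Ω, let λ, μ ≥ 0, and let 0 < τ < 1/L. Let {x^k} be a sequence with x⁰ ∈ Ω and x^{k+1} ∈ Prox_{τp}(x^k − τ∇f(x^k)) for all k ≥ 0. Then: (i) φ(x^k) − φ(x^{k+1}) ≥ ((1/τ − L)/2)‖x^{k+1} − x^k‖² for all k; (ii) the sequence {φ(x^k)} is nonincreasing and converges to a real limit; (iii) the series Σ_k ‖x^{k+1} − x^k‖² converges, and in particular ‖x^{k+1} − x^k‖ → 0 as k → ∞. -/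
open scoped RealInnerProductSpace Classical BigOperators

noncomputable section

/-- basic properties of the PIHT-SGB iterates: sufficient decrease,
monotone convergence of `φ(x^k)`, and square-summability of the successive differences. -/
theorem stmt_13 {n q : ℕ} (l u : Fin n → ℝ) (hl : ∀ i, 0 ≤ l i) (hu : ∀ i, 0 ≤ u i)
    (G : Fin q → Finset (Fin n)) (hG : GroupPartition G)
    (lam μ : ℝ) (hlam : 0 ≤ lam) (hμ : 0 ≤ μ)
    (f : EuclideanSpace ℝ (Fin n) → ℝ)
    (g : EuclideanSpace ℝ (Fin n) → EuclideanSpace ℝ (Fin n))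
    (L : ℝ) (hL : 0 < L) (hsm : StronglySmooth f g L)
    (hbdd : ∃ B : ℝ, ∀ y ∈ box l u, B ≤ f y)
    (τ : ℝ) (hτ1 : 0 < τ) (hτ2 : τ < 1 / L)
    (x : ℕ → EuclideanSpace ℝ (Fin n)) (hx0 : x 0 ∈ box l u)
    (hiter : ∀ k : ℕ, x (k + 1) ∈ proxP l u G τ lam μ (x k - τ • g (x k))) :
    (∀ k : ℕ, ((1 / τ - L) / 2) * ‖x (k + 1) - x k‖ ^ 2 ≤
        phi G f lam μ (x k) - phi G f lam μ (x (k + 1))) ∧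
      ((∀ k : ℕ, phi G f lam μ (x (k + 1)) ≤ phi G f lam μ (x k)) ∧
        ∃ c : ℝ, Filter.Tendsto (fun k => phi G f lam μ (x k)) Filter.atTop (nhds c)) ∧
      (Summable (fun k : ℕ => ‖x (k + 1) - x k‖ ^ 2) ∧
        Filter.Tendsto (fun k : ℕ => ‖x (k + 1) - x k‖) Filter.atTop (nhds 0)) := by
  have hmem : ∀ k, x k ∈ box l u := by
    intro k
    cases k with
    | zero => exact hx0
    | succ k => exact (hiter k).1
  have hτL : 0 < 1 / τ - L := by
    have h1 : τ * L < 1 := by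
      rwa [lt_div_iff₀ hL] at hτ2
    have : L < 1 / τ := by
      rw [lt_div_iff₀ hτ1]; linarith
    linarith
  have hi : ∀ k : ℕ, ((1 / τ - L) / 2) * ‖x (k + 1) - x k‖ ^ 2 ≤
        phi G f lam μ (x k) - phi G f lam μ (x (k + 1)) := by
    intro k
    have h1 := (hiter k).2 (x k) (hmem k)
    have h2 := hsm.2 (x k) (x (k + 1))
    have e1 : x (k + 1) - (x k - τ • g (x k)) = (x (k + 1) - x k) + τ • g (x k) := by abel
    have e2 : x k - (x k - τ • g (x k)) = τ • g (x k) := by abel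
    rw [e1, e2, norm_add_sq_real, inner_smul_right, real_inner_comm] at h1
    unfold phi
    have key : τ * (((1 / τ - L) / 2) * ‖x (k + 1) - x k‖ ^ 2) ≤
        τ * (f (x k) + lam * norm0 (x k) + μ * norm20 G (x k) -
        (f (x (k + 1)) + lam * norm0 (x (k + 1)) + μ * norm20 G (x (k + 1)))) := by
      have h3 := mul_le_mul_of_nonneg_left h2 hτ1.le
      have e3 : τ * (((1 / τ - L) / 2) * ‖x (k + 1) - x k‖ ^ 2) =
          (1 / 2) * ‖x (k + 1) - x k‖ ^ 2 - τ * (L / 2 * ‖x (k + 1) - x k‖ ^ 2) := by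
        field_simp
      rw [e3]
      linarith
    exact le_of_mul_le_mul_left key hτ1
  have hdec : ∀ k : ℕ, phi G f lam μ (x (k + 1)) ≤ phi G f lam μ (x k) := by
    intro k
    have h := hi k
    have : 0 ≤ ((1 / τ - L) / 2) * ‖x (k + 1) - x k‖ ^ 2 := by positivity
    linarith
  obtain ⟨B, hB⟩ := hbdd
  have hlow : ∀ k, B ≤ phi G f lam μ (x k) := by
    intro k
    have h1 := hB _ (hmem k)
    have h2 : 0 ≤ norm0 (x k) := Nat.cast_nonneg _
    have h3 : 0 ≤ norm20 G (x k) := Nat.cast_nonneg _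
    unfold phi
    have := mul_nonneg hlam h2
    have := mul_nonneg hμ h3
    linarith
  have hsum : Summable (fun k : ℕ => ‖x (k + 1) - x k‖ ^ 2) := by
    have hs : Summable (fun k : ℕ => ((1 / τ - L) / 2) * ‖x (k + 1) - x k‖ ^ 2) := by
      refine summable_of_sum_range_le (c := phi G f lam μ (x 0) - B)
        (fun k => by positivity) (fun m => ?_)
      calc _ ≤ ∑ k ∈ Finset.range m, (phi G f lam μ (x k) - phi G f lam μ (x (k + 1))) :=
            Finset.sum_le_sum (fun k _ => hi k)
        _ = phi G f lam μ (x 0) - phi G f lam μ (x m) :=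
            Finset.sum_range_sub' (fun k => phi G f lam μ (x k)) m
        _ ≤ _ := by linarith [hlow m]
    exact (summable_mul_left_iff (by positivity)).1 hs
  refine ⟨hi, ⟨hdec, _, tendsto_atTop_ciInf (antitone_nat_of_succ_le hdec) ⟨B, ?_⟩⟩, hsum, ?_⟩
  · rintro _ ⟨k, rfl⟩
    exact hlow k
  · have h := (hsum.tendsto_atTop_zero).sqrt
    simpa [Real.sqrt_sq (norm_nonneg _)] using h
end
end

section
/- Let f : ℝⁿ → ℝ be strongly smooth with constant L > 0 and bounded from below on Ω, let λ, μ ≥ 0, and let 0 < τ < 1/L. Let {x^k} be a sequence with x⁰ ∈ Ω and x^{k+1} ∈ Prox_{τp}(x^k − τ∇f(x^k)) for all k ≥ 0, and suppose there exists δ > 0 such that for every k ≥ 1 and every index j with x^k_j ≠ 0 one has |x^k_j| ≥ δ. Then there exists K > 0 such that supp(x^k) = supp(x^{k+1}) for all k ≥ K. -/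
open scoped RealInnerProductSpace Classical BigOperators

noncomputable section

/-- the supports of the PIHT-SGB iterates are eventually constant. -/
theorem stmt_14 {n q : ℕ} (l u : Fin n → ℝ) (hl : ∀ i, 0 ≤ l i) (hu : ∀ i, 0 ≤ u i)
    (G : Fin q → Finset (Fin n)) (hG : GroupPartition G)
    (lam μ : ℝ) (hlam : 0 ≤ lam) (hμ : 0 ≤ μ)
    (f : EuclideanSpace ℝ (Fin n) → ℝ)
    (g : EuclideanSpace ℝ (Fin n) → EuclideanSpace ℝ (Fin n))
    (L : ℝ) (hL : 0 < L) (hsm : StronglySmooth f g L)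
    (hbdd : ∃ B : ℝ, ∀ y ∈ box l u, B ≤ f y)
    (τ : ℝ) (hτ1 : 0 < τ) (hτ2 : τ < 1 / L)
    (x : ℕ → EuclideanSpace ℝ (Fin n)) (hx0 : x 0 ∈ box l u)
    (hiter : ∀ k : ℕ, x (k + 1) ∈ proxP l u G τ lam μ (x k - τ • g (x k)))
    (δ : ℝ) (hδ : 0 < δ)
    (hlow : ∀ k : ℕ, 1 ≤ k → ∀ j, x k j ≠ 0 → δ ≤ |x k j|) :
    ∃ K : ℕ, 0 < K ∧ ∀ k ≥ K, supp (x k) = supp (x (k + 1)) := by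
  obtain ⟨B, hB⟩ := hbdd
  have hbox : ∀ k, x k ∈ box l u := by
    intro k
    cases k with
    | zero => exact hx0
    | succ k => exact (hiter k).1
  have hc : 0 < 1 / τ - L := by
    have h1 : τ * L < 1 := by rwa [lt_div_iff₀ hL] at hτ2
    have : L < 1 / τ := by rw [lt_div_iff₀ hτ1]; linarith
    linarith
  have hdesc : ∀ k, phi G f lam μ (x (k + 1)) + (1 / τ - L) / 2 * ‖x (k + 1) - x k‖ ^ 2
      ≤ phi G f lam μ (x k) := by
    intro k
    have h1 := (hiter k).2 (x k) (hbox k)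
    have h2 := hsm.2 (x k) (x (k + 1))
    have e1 : x (k + 1) - (x k - τ • g (x k)) = (x (k + 1) - x k) + τ • g (x k) := by abel
    have e2 : x k - (x k - τ • g (x k)) = τ • g (x k) := by abel
    rw [e1, e2, norm_add_sq_real, real_inner_smul_right, real_inner_comm] at h1
    unfold phi
    have h3 : τ * (⟪g (x k), x (k + 1) - x k⟫ + 1 / τ / 2 * ‖x (k + 1) - x k‖ ^ 2
        + lam * norm0 (x (k + 1)) + μ * norm20 G (x (k + 1)))
        ≤ τ * (lam * norm0 (x k) + μ * norm20 G (x k)) := by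
      have : τ * (1 / τ / 2 * ‖x (k + 1) - x k‖ ^ 2) = 1 / 2 * ‖x (k + 1) - x k‖ ^ 2 := by
        field_simp
      rw [mul_add, mul_add, mul_add, this]
      linarith
    have h4 := le_of_mul_le_mul_left h3 hτ1
    linarith
  have hanti : Antitone (fun k => phi G f lam μ (x k)) := by
    apply antitone_nat_of_succ_le
    intro k
    have := hdesc k
    have h5 : 0 ≤ (1 / τ - L) / 2 * ‖x (k + 1) - x k‖ ^ 2 := by positivity
    linarith
  have hbb : BddBelow (Set.range (fun k => phi G f lam μ (x k))) := by
    refine ⟨B, ?_⟩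
    rintro _ ⟨k, rfl⟩
    have h6 := hB _ (hbox k)
    have h7 : 0 ≤ lam * norm0 (x k) := mul_nonneg hlam (Nat.cast_nonneg _)
    have h8 : 0 ≤ μ * norm20 G (x k) := mul_nonneg hμ (Nat.cast_nonneg _)
    simp only [phi]
    linarith
  have hlim := tendsto_atTop_ciInf hanti hbb
  have hdiff := hlim.sub (hlim.comp (Filter.tendsto_add_atTop_nat 1))
  rw [sub_self] at hdiff
  have hpos : 0 < (1 / τ - L) / 2 * δ ^ 2 := by positivity
  obtain ⟨K, hK⟩ := Filter.eventually_atTop.1 (hdiff.eventually (gt_mem_nhds hpos))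
  refine ⟨K + 1, Nat.succ_pos _, fun k hk => ?_⟩
  have h9 := hK k (by omega)
  simp only [Function.comp] at h9
  have h10 := hdesc k
  have h11 : ‖x (k + 1) - x k‖ ^ 2 < δ ^ 2 := by
    apply lt_of_mul_lt_mul_left (a := (1 / τ - L) / 2) _ (by positivity)
    linarith
  have h12 : ‖x (k + 1) - x k‖ < δ := lt_of_pow_lt_pow_left₀ 2 hδ.le h11
  have h13 : ∀ j, |x (k + 1) j - x k j| < δ := by
    intro j
    have := PiLp.norm_apply_le (x (k + 1) - x k) j
    rw [PiLp.sub_apply, Real.norm_eq_abs] at this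
    linarith
  ext j
  simp only [supp, Set.mem_setOf_eq]
  have h14 := h13 j
  constructor
  · intro h h'
    have := hlow k (by omega) j h
    rw [h', zero_sub, abs_neg] at h14
    linarith
  · intro h h'
    have := hlow (k + 1) (by omega) j h
    rw [h', sub_zero] at h14
    linarith
end
end

section
/- Let f : ℝⁿ → ℝ be continuously differentiable, strongly smooth with constant L > 0, and bounded from below on Ω; let λ, μ ≥ 0 and 0 < τ < 1/L. Let {x^k} be a sequence with x⁰ ∈ Ω and x^{k+1} ∈ Prox_{τp}(x^k − τ∇f(x^k)) for all k ≥ 0. If x* ∈ ℝⁿ is an accumulation point of {x^k} (i.e. some subsequence of {x^k} converges to x*), then x* ∈ Ω and x* is a τ-stationary point, i.e. x* ∈ Prox_{τp}(x* − τ∇f(x*)). -/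
open scoped RealInnerProductSpace Classical BigOperators

noncomputable section

/-- any accumulation point of the PIHT-SGB iterates is a `τ`-stationary
point. -/
theorem stmt_15 {n q : ℕ} (l u : Fin n → ℝ) (hl : ∀ i, 0 ≤ l i) (hu : ∀ i, 0 ≤ u i)
    (G : Fin q → Finset (Fin n)) (hG : GroupPartition G)
    (lam μ : ℝ) (hlam : 0 ≤ lam) (hμ : 0 ≤ μ)
    (f : EuclideanSpace ℝ (Fin n) → ℝ) (hc1 : ContDiff ℝ 1 f)
    (g : EuclideanSpace ℝ (Fin n) → EuclideanSpace ℝ (Fin n))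
    (L : ℝ) (hL : 0 < L) (hsm : StronglySmooth f g L)
    (hbdd : ∃ B : ℝ, ∀ y ∈ box l u, B ≤ f y)
    (τ : ℝ) (hτ1 : 0 < τ) (hτ2 : τ < 1 / L)
    (x : ℕ → EuclideanSpace ℝ (Fin n)) (hx0 : x 0 ∈ box l u)
    (hiter : ∀ k : ℕ, x (k + 1) ∈ proxP l u G τ lam μ (x k - τ • g (x k)))
    (xs : EuclideanSpace ℝ (Fin n))
    (hacc : ∃ σ : ℕ → ℕ, StrictMono σ ∧
      Filter.Tendsto (fun i => x (σ i)) Filter.atTop (nhds xs)) :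
    xs ∈ box l u ∧ xs ∈ proxP l u G τ lam μ (xs - τ • g xs) := by
  obtain ⟨σ, hσ, hlim⟩ := hacc
  obtain ⟨B, hB⟩ := hbdd
  obtain ⟨hgrad, hdesc⟩ := hsm
  have hbox : ∀ k, x k ∈ box l u := by
    intro k
    cases k with
    | zero => exact hx0
    | succ k => exact (hiter k).1
  have hclosed : IsClosed (box l u) := by
    have : box l u = ⋂ i, {x : EuclideanSpace ℝ (Fin n) | -l i ≤ x i ∧ x i ≤ u i} := by
      ext y; simp [box]
    rw [this]
    refine isClosed_iInter fun i => ?_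
    have hci : Continuous fun y : EuclideanSpace ℝ (Fin n) => y i := by fun_prop
    exact (isClosed_le continuous_const hci).inter (isClosed_le hci continuous_const)
  have hxs : xs ∈ box l u :=
    hclosed.mem_of_tendsto hlim (Filter.Eventually.of_forall fun i => hbox _)
  have hgc : Continuous g := by
    have h1 : Continuous (fderiv ℝ f) := hc1.continuous_fderiv (by norm_num)
    have h2 : g = fun y => (InnerProductSpace.toDual ℝ _).symm (fderiv ℝ f y) := by
      funext y
      rw [(hgrad y).hasFDerivAt.fderiv]
      simp
    rw [h2]
    exact (LinearIsometryEquiv.continuous _).comp h1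
  -- sufficient decrease
  have hτL : τ * L < 1 := by rwa [lt_div_iff₀ hL] at hτ2
  set c := 1 - τ * L with hc
  have hcpos : 0 < c := by linarith
  have hdec : ∀ k, c / 2 * ‖x (k+1) - x k‖ ^ 2 ≤
      τ * phi G f lam μ (x k) - τ * phi G f lam μ (x (k+1)) := by
    intro k
    have h1 := (hiter k).2 (x k) (hbox k)
    have h2 := hdesc (x k) (x (k+1))
    have e1 : x (k+1) - (x k - τ • g (x k)) = (x (k+1) - x k) + τ • g (x k) := by abel
    have e2 : x k - (x k - τ • g (x k)) = τ • g (x k) := by abel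
    rw [e1, e2, norm_add_sq_real, inner_smul_right, real_inner_comm] at h1
    have h3 := mul_le_mul_of_nonneg_left h2 hτ1.le
    simp only [phi]
    rw [hc]
    linarith
  have hphiB : ∀ k, B ≤ phi G f lam μ (x k) := by
    intro k
    have := hB _ (hbox k)
    have h1 : 0 ≤ lam * norm0 (x k) := mul_nonneg hlam (by unfold norm0; positivity)
    have h2 : 0 ≤ μ * norm20 G (x k) := mul_nonneg hμ (by unfold norm20; positivity)
    simp only [phi]; linarith
  have hanti : Antitone fun k => τ * phi G f lam μ (x k) := by
    apply antitone_nat_of_succ_le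
    intro k
    have := hdec k
    have : 0 ≤ c / 2 * ‖x (k+1) - x k‖ ^ 2 := by positivity
    linarith
  have hconv := tendsto_atTop_ciInf hanti
    ⟨τ * B, by rintro _ ⟨k, rfl⟩; exact mul_le_mul_of_nonneg_left (hphiB k) hτ1.le⟩
  have hdiff := hconv.sub (hconv.comp (Filter.tendsto_add_atTop_nat 1))
  rw [sub_self] at hdiff
  have hsq : Filter.Tendsto (fun k => c / 2 * ‖x (k+1) - x k‖ ^ 2) Filter.atTop (nhds 0) :=
    squeeze_zero (fun k => by positivity) hdec hdiff
  have hsq2 : Filter.Tendsto (fun k => ‖x (k+1) - x k‖ ^ 2) Filter.atTop (nhds 0) := by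
    have := hsq.const_mul (2 / c)
    rw [mul_zero] at this
    refine this.congr fun k => ?_
    field_simp
  have hstep : Filter.Tendsto (fun k => x (k+1) - x k) Filter.atTop (nhds 0) := by
    rw [tendsto_zero_iff_norm_tendsto_zero]
    have := hsq2.sqrt
    simpa using this
  have hlim1 : Filter.Tendsto (fun i => x (σ i + 1)) Filter.atTop (nhds xs) := by
    have := (hstep.comp hσ.tendsto_atTop).add hlim
    simpa using this
  have hev : ∀ᶠ i in Filter.atTop, ∀ j, xs j ≠ 0 → x (σ i + 1) j ≠ 0 := by
    rw [Filter.eventually_all]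
    intro j
    by_cases hj : xs j = 0
    · simp [hj]
    · have hcj : Continuous fun y : EuclideanSpace ℝ (Fin n) => y j := by fun_prop
      have := ((hcj.tendsto xs).comp hlim1).eventually_ne hj
      filter_upwards [this] with i hi _ using hi
  refine ⟨hxs, hxs, fun v hv => ?_⟩
  have hs : Filter.Tendsto (fun i => x (σ i) - τ • g (x (σ i))) Filter.atTop
      (nhds (xs - τ • g xs)) :=
    hlim.sub (((hgc.tendsto xs).comp hlim).const_smul τ)
  have hA := (((((hlim1.sub hs).norm).pow 2).const_mul (1/2 : ℝ)).add_const
    (τ * lam * norm0 xs)).add_const (τ * μ * norm20 G xs)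
  have hC := ((((hs.const_sub v).norm.pow 2).const_mul (1/2 : ℝ)).add_const
    (τ * lam * norm0 v)).add_const (τ * μ * norm20 G v)
  refine le_of_tendsto_of_tendsto hA hC ?_
  filter_upwards [hev] with i hi
  have h1 := (hiter (σ i)).2 v hv
  have n0 : norm0 xs ≤ norm0 (x (σ i + 1)) := by
    unfold norm0
    exact_mod_cast Finset.card_le_card
      (Finset.monotone_filter_right _ fun j _ hj => hi j hj)
  have n2 : norm20 G xs ≤ norm20 G (x (σ i + 1)) := by
    unfold norm20
    refine Nat.cast_le.mpr (Finset.card_le_card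
      (Finset.monotone_filter_right _ ?_))
    rintro j - ⟨k, hk, hk2⟩
    exact ⟨k, hk, hi k hk2⟩
  have m0 := mul_le_mul_of_nonneg_left n0 (mul_nonneg hτ1.le hlam)
  have m2 := mul_le_mul_of_nonneg_left n2 (mul_nonneg hτ1.le hμ)
  linarith
end
end

section
/- Let f : ℝⁿ → ℝ be strongly smooth with constant L > 0, let λ, μ ≥ 0, and let 0 < τ < 1/L. Let {x^k} be a sequence with x⁰ ∈ Ω and x^{k+1} ∈ Prox_{τp}(x^k − τ∇f(x^k)) for all k ≥ 0. Suppose there exists δ > 0 such that for every k ≥ 1 and every index j with x^k_j ≠ 0 one has |x^k_j| ≥ δ, and suppose φ* ∈ ℝ satisfies φ* ≤ φ(x^k) for all k. Then the number of indices k ≥ 1 with supp(x^k) ≠ supp(x^{k+1}) is at most 2(φ(x⁰) − φ*)/(δ²(1/τ − L)); that is, for every N, the cardinality of {k : 1 ≤ k ≤ N, supp(x^k) ≠ supp(x^{k+1})} does not exceed 2(φ(x⁰) − φ*)/(δ²(1/τ − L)). -/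
open scoped RealInnerProductSpace Classical BigOperators

noncomputable section

theorem aux_key {n q : ℕ} (l u : Fin n → ℝ) (G : Fin q → Finset (Fin n)) (lam μ : ℝ)
    (f : EuclideanSpace ℝ (Fin n) → ℝ)
    (g : EuclideanSpace ℝ (Fin n) → EuclideanSpace ℝ (Fin n))
    (L : ℝ) (hsm : StronglySmooth f g L) (τ : ℝ) (hτ1 : 0 < τ)
    (a b : EuclideanSpace ℝ (Fin n)) (ha : a ∈ box l u)
    (hb : b ∈ proxP l u G τ lam μ (a - τ • g a)) :
    (1 / τ - L) / 2 * ‖b - a‖ ^ 2 + phi G f lam μ b ≤ phi G f lam μ a := by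
  have h1 := hb.2 a ha
  have h2 := hsm.2 a b
  have e1 : b - (a - τ • g a) = (b - a) + τ • g a := by abel
  have e2 : a - (a - τ • g a) = τ • g a := by abel
  rw [e1, e2, norm_add_sq_real, real_inner_smul_right, real_inner_comm] at h1
  unfold phi
  have h3 : τ * (1 / (2 * τ) * ‖b - a‖ ^ 2 + inner ℝ (g a) (b - a) + lam * norm0 b
      + μ * norm20 G b) ≤ τ * (lam * norm0 a + μ * norm20 G a) := by
    have : τ * (1 / (2 * τ) * ‖b - a‖ ^ 2) = 1 / 2 * ‖b - a‖ ^ 2 := by field_simp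
    linarith
  have h4 := le_of_mul_le_mul_left h3 hτ1
  have h5 : (1 / τ - L) / 2 * ‖b - a‖ ^ 2
      = 1 / (2 * τ) * ‖b - a‖ ^ 2 - L / 2 * ‖b - a‖ ^ 2 := by field_simp
  linarith

theorem aux_supp {n : ℕ} (a b : EuclideanSpace ℝ (Fin n)) (δ : ℝ) (hδ : 0 < δ)
    (ha : ∀ j, a j ≠ 0 → δ ≤ |a j|) (hb : ∀ j, b j ≠ 0 → δ ≤ |b j|)
    (h : supp a ≠ supp b) : δ ^ 2 ≤ ‖b - a‖ ^ 2 := by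
  have : ∃ j, δ ≤ |(b - a) j| := by
    by_contra! hc
    apply h
    ext j
    have hj := hc j
    simp only [supp, Set.mem_setOf_eq, PiLp.sub_apply] at hj ⊢
    constructor
    · intro h1 h2
      rw [h2, zero_sub, abs_neg] at hj
      linarith [ha j h1]
    · intro h1 h2
      rw [h2, sub_zero] at hj
      linarith [hb j h1]
  obtain ⟨j, hj⟩ := this
  have h2 := PiLp.norm_apply_le (b - a) j
  rw [Real.norm_eq_abs] at h2
  exact pow_le_pow_left₀ hδ.le (hj.trans h2) 2

/-- the number of support changes of the PIHT-SGB iterates is at most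
`2(φ(x⁰) - φ*)/(δ²(1/τ - L))`. -/
theorem stmt_16 {n q : ℕ} (l u : Fin n → ℝ) (hl : ∀ i, 0 ≤ l i) (hu : ∀ i, 0 ≤ u i)
    (G : Fin q → Finset (Fin n)) (hG : GroupPartition G)
    (lam μ : ℝ) (hlam : 0 ≤ lam) (hμ : 0 ≤ μ)
    (f : EuclideanSpace ℝ (Fin n) → ℝ)
    (g : EuclideanSpace ℝ (Fin n) → EuclideanSpace ℝ (Fin n))
    (L : ℝ) (hL : 0 < L) (hsm : StronglySmooth f g L)
    (τ : ℝ) (hτ1 : 0 < τ) (hτ2 : τ < 1 / L)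
    (x : ℕ → EuclideanSpace ℝ (Fin n)) (hx0 : x 0 ∈ box l u)
    (hiter : ∀ k : ℕ, x (k + 1) ∈ proxP l u G τ lam μ (x k - τ • g (x k)))
    (δ : ℝ) (hδ : 0 < δ)
    (hlow : ∀ k : ℕ, 1 ≤ k → ∀ j, x k j ≠ 0 → δ ≤ |x k j|)
    (φs : ℝ) (hφs : ∀ k : ℕ, φs ≤ phi G f lam μ (x k)) :
    ∀ N : ℕ, (((Finset.Icc 1 N).filter
        (fun k => supp (x k) ≠ supp (x (k + 1)))).card : ℝ) ≤
      2 * (phi G f lam μ (x 0) - φs) / (δ ^ 2 * (1 / τ - L)) := by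
  have hC : 0 < 1 / τ - L := by
    rw [lt_div_iff₀ hL] at hτ2
    rw [sub_pos, lt_div_iff₀ hτ1]
    linarith
  have hbox : ∀ k, x k ∈ box l u := by
    intro k
    cases k with
    | zero => exact hx0
    | succ k => exact (hiter k).1
  have key := fun k => aux_key l u G lam μ f g L hsm τ hτ1 (x k) (x (k + 1)) (hbox k) (hiter k)
  intro N
  have hind : (((Finset.Icc 1 N).filter
        (fun k => supp (x k) ≠ supp (x (k + 1)))).card : ℝ) * ((1 / τ - L) / 2 * δ ^ 2)
        + phi G f lam μ (x (N + 1)) ≤ phi G f lam μ (x 0) := by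
    induction N with
    | zero =>
      have := key 0
      have h0 : 0 ≤ (1 / τ - L) / 2 * ‖x (0 + 1) - x 0‖ ^ 2 := by positivity
      simp only [zero_lt_one, Finset.Icc_eq_empty_of_lt, Finset.filter_empty, Finset.card_empty,
        Nat.cast_zero, zero_mul]
      linarith
    | succ N ih =>
      have hk := key (N + 1)
      rw [← Finset.insert_Icc_right_eq_Icc_add_one (by omega), Finset.filter_insert]
      split_ifs with hs
      · rw [Finset.card_insert_of_notMem (by simp)]
        have h1 := aux_supp _ _ δ hδ (hlow (N + 1) (by omega)) (hlow (N + 1 + 1) (by omega)) hs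
        have h2 := mul_le_mul_of_nonneg_left h1 (half_pos hC).le
        push_cast
        linarith
      · have h0 : 0 ≤ (1 / τ - L) / 2 * ‖x (N + 1 + 1) - x (N + 1)‖ ^ 2 := by positivity
        linarith
  rw [le_div_iff₀ (by positivity)]
  linarith [hφs (N + 1)]
end
end

section
/- Let f : ℝⁿ → ℝ be differentiable, λ, μ ≥ 0, and τ > 0. Let x ∈ Ω, let x⁺ ∈ Prox_{τp}(x − τ∇f(x)), and let S = supp(x⁺). Then x⁺ is the Euclidean projection of x − τ∇f(x) onto the closed convex set Ω_S = {y ∈ Ω : supp(y) ⊆ S}, i.e. ‖x⁺ − (x − τ∇f(x))‖ ≤ ‖y − (x − τ∇f(x))‖ for every y ∈ Ω_S. -/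
open scoped RealInnerProductSpace Classical BigOperators

noncomputable section

/-- a point `x⁺ ∈ Prox_{τp}(x - τ∇f(x))` is the Euclidean projection of
`x - τ∇f(x)` onto `Ω_S = {y ∈ Ω : supp(y) ⊆ supp(x⁺)}`. -/
theorem stmt_17 {n q : ℕ} (l u : Fin n → ℝ) (hl : ∀ i, 0 ≤ l i) (hu : ∀ i, 0 ≤ u i)
    (G : Fin q → Finset (Fin n)) (hG : GroupPartition G)
    (lam μ : ℝ) (hlam : 0 ≤ lam) (hμ : 0 ≤ μ)
    (f : EuclideanSpace ℝ (Fin n) → ℝ)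
    (g : EuclideanSpace ℝ (Fin n) → EuclideanSpace ℝ (Fin n))
    (hf : ∀ y, HasGradientAt f (g y) y)
    (τ : ℝ) (hτ : 0 < τ)
    (x xp : EuclideanSpace ℝ (Fin n)) (hx : x ∈ box l u)
    (hxp : xp ∈ proxP l u G τ lam μ (x - τ • g x)) :
    ∀ y ∈ box l u, supp y ⊆ supp xp →
      ‖xp - (x - τ • g x)‖ ≤ ‖y - (x - τ • g x)‖ := by
  intro y hy hsub
  have h := hxp.2 y hy
  have hs : ∀ i, y i ≠ 0 → xp i ≠ 0 := fun i hi => hsub hi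
  have h0 : norm0 y ≤ norm0 xp := by
    unfold norm0
    refine Nat.cast_le.2 (Finset.card_le_card ?_)
    intro i hi
    rw [Finset.mem_filter] at hi ⊢
    exact ⟨hi.1, hs i hi.2⟩
  have h1 : norm20 G y ≤ norm20 G xp := by
    unfold norm20
    refine Nat.cast_le.2 (Finset.card_le_card ?_)
    intro i hi
    rw [Finset.mem_filter] at hi ⊢
    obtain ⟨h, j, hj, hj2⟩ := hi
    exact ⟨h, j, hj, hs j hj2⟩
  have h2 := mul_le_mul_of_nonneg_left h0 (mul_nonneg hτ.le hlam)
  have h3 := mul_le_mul_of_nonneg_left h1 (mul_nonneg hτ.le hμ)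
  refine (sq_le_sq₀ (norm_nonneg _) (norm_nonneg _)).1 ?_
  linarith
end
end
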